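/- arXiv:2406.14078 — 7 statements merged into one kernel-verified Lean document; each statement's English description precedes it below -/
import Mathlib

section
/- Let n ≥ 2 and fix numbers m, d ≥ 2 of inputs and outcomes per party. Let G be a finite family of subsets g ⊆ {1,…,n} with |g| ≥ 2, and for each g ∈ G let I^g be a Bell expression such that (i) for every bipartition S|S̄ of {1,…,n} and every n-partite correlation p that is local across S|S̄, if there exist i, j ∈ g with i ∈ S and j ∈ S̄ then I^g(p) ≤ 0, and (ii) all the I^g have the same positive part I₊. Let T be a Bell expression with nonnegative coefficients such that, coefficientwise, T ≤ I₋^g for every g ∈ G (T is a common part of all the negative parts). Set γ = max over bipartitions S|S̄ of |{g ∈ G : g ⊆ S or g ⊆ S̄}|. Then every bilocal n-partite correlation p satisfies ∑_{g∈G} I^g(p) ≤ γ·(I₊(p) − T(p)). -/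
/-- A non-signaling correlation with `d` outcomes and `m` inputs per party, for a
finite set `ι` of parties: nonnegative, normalized, and non-signaling. -/
def IsNSCorr {ι : Type} [Fintype ι] [DecidableEq ι] (d m : ℕ)
    (p : (ι → Fin d) → (ι → Fin m) → ℝ) : Prop :=
  (∀ a x, 0 ≤ p a x) ∧ (∀ x, ∑ a : ι → Fin d, p a x = 1) ∧
  (∀ (i : ι) (a : ι → Fin d) (x x' : ι → Fin m), (∀ j, j ≠ i → x j = x' j) →
    ∑ v : Fin d, p (Function.update a i v) x = ∑ v : Fin d, p (Function.update a i v) x')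

/-- `p` is local across the bipartition `S | Sᶜ` of the `n` parties. -/
def IsLocalAcross (n d m : ℕ) (S : Finset (Fin n))
    (p : (Fin n → Fin d) → (Fin n → Fin m) → ℝ) : Prop :=
  ∃ (N : ℕ) (q : Fin N → ℝ)
    (pS : Fin N → ({i : Fin n // i ∈ S} → Fin d) → ({i : Fin n // i ∈ S} → Fin m) → ℝ)
    (pT : Fin N → ({i : Fin n // i ∉ S} → Fin d) → ({i : Fin n // i ∉ S} → Fin m) → ℝ),
    (∀ l, 0 ≤ q l) ∧ (∑ l, q l = 1) ∧
    (∀ l, IsNSCorr d m (pS l)) ∧ (∀ l, IsNSCorr d m (pT l)) ∧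
    (∀ a x, p a x =
      ∑ l, q l * pS l (fun i => a i.1) (fun i => x i.1) * pT l (fun i => a i.1) (fun i => x i.1))

/-- `p` is bilocal: a convex combination of correlations, each local across some
nontrivial bipartition. -/
def IsBilocal (n d m : ℕ) (p : (Fin n → Fin d) → (Fin n → Fin m) → ℝ) : Prop :=
  ∃ (N : ℕ) (q : Fin N → ℝ)
    (ps : Fin N → (Fin n → Fin d) → (Fin n → Fin m) → ℝ) (S : Fin N → Finset (Fin n)),
    (∀ l, 0 ≤ q l) ∧ (∑ l, q l = 1) ∧
    (∀ l, (S l).Nonempty ∧ S l ≠ Finset.univ ∧ IsLocalAcross n d m (S l) (ps l)) ∧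
    (∀ a x, p a x = ∑ l, q l * ps l a x)

/-- `p` is a mixture of products over the blocks (the fibers) of the partition
function `π`. -/
def IsProdForPartition (n d m : ℕ) (π : Fin n → Fin n)
    (p : (Fin n → Fin d) → (Fin n → Fin m) → ℝ) : Prop :=
  ∃ (N : ℕ) (q : Fin N → ℝ)
    (pB : Fin N → (t : Fin n) →
      ({i : Fin n // π i = t} → Fin d) → ({i : Fin n // π i = t} → Fin m) → ℝ),
    (∀ l, 0 ≤ q l) ∧ (∑ l, q l = 1) ∧
    (∀ l t, IsNSCorr d m (pB l t)) ∧
    (∀ a x, p a x = ∑ l, q l * ∏ t : Fin n, pB l t (fun i => a i.1) (fun i => x i.1))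

/-- `p` is `k`-producible: a convex combination of correlations, each a mixture of
products over the blocks of a partition of the parties into blocks of size at most `k`. -/
def IsKProducible (n d m k : ℕ) (p : (Fin n → Fin d) → (Fin n → Fin m) → ℝ) : Prop :=
  ∃ (N : ℕ) (q : Fin N → ℝ)
    (ps : Fin N → (Fin n → Fin d) → (Fin n → Fin m) → ℝ) (π : Fin N → (Fin n → Fin n)),
    (∀ l, 0 ≤ q l) ∧ (∑ l, q l = 1) ∧
    (∀ l, (∀ t, (Finset.univ.filter (fun i => π l i = t)).card ≤ k) ∧
      IsProdForPartition n d m (π l) (ps l)) ∧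
    (∀ a x, p a x = ∑ l, q l * ps l a x)

/-- The value of the Bell expression with coefficients `β` on the correlation `p`. -/
def BellApply {n d m : ℕ} (β : (Fin n → Fin d) → (Fin n → Fin m) → ℝ)
    (p : (Fin n → Fin d) → (Fin n → Fin m) → ℝ) : ℝ :=
  ∑ a, ∑ x, β a x * p a x

theorem IsLocalAcross.nonneg {n d m : ℕ} {S : Finset (Fin n)}
    {p : (Fin n → Fin d) → (Fin n → Fin m) → ℝ} (h : IsLocalAcross n d m S p)
    (a : Fin n → Fin d) (x : Fin n → Fin m) : 0 ≤ p a x := by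
  obtain ⟨N, q, pS, pT, hq, -, hS, hT, hp⟩ := h
  rw [hp]
  exact Finset.sum_nonneg fun l _ =>
    mul_nonneg (mul_nonneg (hq l) ((hS l).1 _ _)) ((hT l).1 _ _)

theorem BellApply_sum_mul {n d m N : ℕ} (β : (Fin n → Fin d) → (Fin n → Fin m) → ℝ)
    (q : Fin N → ℝ) (ps : Fin N → (Fin n → Fin d) → (Fin n → Fin m) → ℝ)
    {p : (Fin n → Fin d) → (Fin n → Fin m) → ℝ} (hp : ∀ a x, p a x = ∑ l, q l * ps l a x) :
    BellApply β p = ∑ l, q l * BellApply β (ps l) := by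
  simp only [BellApply, hp, Finset.mul_sum]
  rw [Finset.sum_comm (s := (Finset.univ : Finset (Fin N)))]
  refine Finset.sum_congr rfl fun a _ => ?_
  rw [Finset.sum_comm (s := (Finset.univ : Finset (Fin N)))]
  exact Finset.sum_congr rfl fun x _ => Finset.sum_congr rfl fun l _ => mul_left_comm _ _ _

/-- A Bell expression is bounded by its positive part minus any part of its negative part. -/
theorem BellApply_le_sub {n d m : ℕ} {β P T p : (Fin n → Fin d) → (Fin n → Fin m) → ℝ}
    (hP : ∀ a x, max (β a x) 0 = P a x) (hT : ∀ a x, T a x ≤ max (-(β a x)) 0)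
    (hp : ∀ a x, 0 ≤ p a x) : BellApply β p ≤ BellApply P p - BellApply T p := by
  simp only [BellApply, ← Finset.sum_sub_distrib, ← sub_mul]
  refine Finset.sum_le_sum fun a _ => Finset.sum_le_sum fun x _ =>
    mul_le_mul_of_nonneg_right ?_ (hp a x)
  have h : max (β a x) 0 - max (-(β a x)) 0 = β a x := max_zero_sub_max_neg_zero_eq_self _
  linarith [hP a x, hT a x]

/-- If all terms are at most `c`, and those outside the subset cut out by `r` are nonpositive,
then the sum is at most `k * c` for every `k` between the sizes of the subset and the whole. -/
theorem sum_le_mul_of_le_of_nonpos {α : Type*} (G : Finset α) (r : α → Prop) [DecidablePred r]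
    (f : α → ℝ) (c : ℝ) (k : ℕ) (hf : ∀ g ∈ G, f g ≤ c) (hneg : ∀ g ∈ G, ¬ r g → f g ≤ 0)
    (hk : (G.filter r).card ≤ k) (hkG : k ≤ G.card) : ∑ g ∈ G, f g ≤ k * c := by
  rcases le_total 0 c with hc | hc
  · calc ∑ g ∈ G, f g ≤ ∑ g ∈ G, if r g then c else 0 :=
          Finset.sum_le_sum fun g hg => by
            split_ifs with h
            exacts [hf g hg, hneg g hg h]
      _ = (G.filter r).card * c := by rw [← Finset.sum_filter]; simp
      _ ≤ k * c := mul_le_mul_of_nonneg_right (by exact_mod_cast hk) hc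
  · calc ∑ g ∈ G, f g ≤ G.card * c := by simpa using Finset.sum_le_sum hf
      _ ≤ k * c := mul_le_mul_of_nonpos_right (by exact_mod_cast hkG) hc

/-- For a family of Bell expressions `I^g = β g` (indexed by subsets
`g` of the parties, each of size at least 2) that all have the same positive part
`I₊` and satisfy `I^g(p) ≤ 0` on correlations local across any bipartition splitting
`g`, and for any nonnegative common part `T` of all the negative parts, every bilocal
correlation `p` satisfies `∑_{g ∈ G} I^g(p) ≤ γ (I₊(p) - T(p))`, where `γ` is the
maximum over bipartitions `S|Sᶜ` of the number of `g ∈ G` contained in `S` or in `Sᶜ`. -/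
theorem statement0 (n m d : ℕ) (hn : 2 ≤ n) (hm : 2 ≤ m) (hd : 2 ≤ d)
    (G : Finset (Finset (Fin n))) (hG : ∀ g ∈ G, 2 ≤ g.card)
    (β : Finset (Fin n) → (Fin n → Fin d) → (Fin n → Fin m) → ℝ)
    (Iplus : (Fin n → Fin d) → (Fin n → Fin m) → ℝ)
    (hIplus : ∀ g ∈ G, ∀ a x, max (β g a x) 0 = Iplus a x)
    (hloc : ∀ g ∈ G, ∀ S : Finset (Fin n), S.Nonempty → S ≠ Finset.univ →
      ∀ p : (Fin n → Fin d) → (Fin n → Fin m) → ℝ, IsLocalAcross n d m S p →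
        (∃ i ∈ g, i ∈ S) → (∃ j ∈ g, j ∉ S) → BellApply (β g) p ≤ 0)
    (T : (Fin n → Fin d) → (Fin n → Fin m) → ℝ)
    (hT0 : ∀ a x, 0 ≤ T a x)
    (hT : ∀ g ∈ G, ∀ a x, T a x ≤ max (-(β g a x)) 0)
    (p : (Fin n → Fin d) → (Fin n → Fin m) → ℝ)
    (hp : IsBilocal n d m p) :
    ∑ g ∈ G, BellApply (β g) p ≤
      (((Finset.univ.powerset.filter
            (fun S : Finset (Fin n) => S.Nonempty ∧ S ≠ Finset.univ)).sup
          (fun S => (G.filter (fun g => g ⊆ S ∨ g ⊆ Sᶜ)).card) : ℕ) : ℝ) *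
        (BellApply Iplus p - BellApply T p) := by
  obtain ⟨N, q, ps, S, hq, -, hS, hpeq⟩ := hp
  set γ := (Finset.univ.powerset.filter
            (fun S : Finset (Fin n) => S.Nonempty ∧ S ≠ Finset.univ)).sup
          (fun S => (G.filter (fun g => g ⊆ S ∨ g ⊆ Sᶜ)).card)
  have hγG : γ ≤ G.card := Finset.sup_le fun S _ => Finset.card_filter_le _ _
  have key : ∀ l, ∑ g ∈ G, BellApply (β g) (ps l) ≤
      γ * (BellApply Iplus (ps l) - BellApply T (ps l)) := by
    intro l
    obtain ⟨hne, huniv, hl⟩ := hS l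
    refine sum_le_mul_of_le_of_nonpos G (fun g => g ⊆ S l ∨ g ⊆ (S l)ᶜ) _ _ _
      (fun g hg => BellApply_le_sub (hIplus g hg) (hT g hg) hl.nonneg) ?_ ?_ hγG
    · intro g hg h
      simp only [not_or, Finset.not_subset, Finset.mem_compl, not_not] at h
      exact hloc g hg (S l) hne huniv _ hl h.2 h.1
    · have hmem : S l ∈ Finset.univ.powerset.filter
          (fun S : Finset (Fin n) => S.Nonempty ∧ S ≠ Finset.univ) :=
        Finset.mem_filter.2 ⟨Finset.mem_powerset.2 (Finset.subset_univ _), hne, huniv⟩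
      exact Finset.le_sup (f := fun S => (G.filter (fun g => g ⊆ S ∨ g ⊆ Sᶜ)).card) hmem
  simp only [fun B => BellApply_sum_mul B q ps hpeq]
  rw [Finset.sum_comm, ← Finset.sum_sub_distrib, Finset.mul_sum]
  refine Finset.sum_le_sum fun l _ => ?_
  rw [← Finset.mul_sum]
  linarith [mul_le_mul_of_nonneg_left (key l) (hq l)]
end

section
/- Let n ≥ 2 and let p be an n-partite correlation with 2 inputs and 2 outcomes per party. If p is local across a bipartition S|S̄ and i ∈ S, j ∈ S̄, then the lifted CHSH expression satisfies I^{i,j}_{0|0}(p) ≤ 0. -/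
/-- The outcome/input tuple with a single `1` at position `i` and `0` elsewhere. -/
def unitVec (n : ℕ) (i : Fin n) : Fin n → Fin 2 :=
  Function.update (fun _ => 0) i 1

/-- The lifted CHSH expression `I^{i,j}_{0|0}(p) =
p(0|0) − p(eᵢ|eᵢ) − p(eⱼ|eⱼ) − p(0|eᵢ+eⱼ)`. -/
def chshLift {n : ℕ} (i j : Fin n) (p : (Fin n → Fin 2) → (Fin n → Fin 2) → ℝ) : ℝ :=
  p (fun _ => 0) (fun _ => 0) - p (unitVec n i) (unitVec n i)
    - p (unitVec n j) (unitVec n j)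
    - p (fun _ => 0) (Function.update (unitVec n i) j 1)

theorem IsNSCorr.zero_le_add {ι : Type} [Fintype ι] [DecidableEq ι]
    {p : (ι → Fin 2) → (ι → Fin 2) → ℝ} (hp : IsNSCorr 2 2 p) (i : ι) :
    p (fun _ => 0) (fun _ => 0) ≤
      p (Function.update (fun _ => 0) i 1) (Function.update (fun _ => 0) i 1) +
        p (fun _ => 0) (Function.update (fun _ => 0) i 1) := by
  obtain ⟨hpos, -, hns⟩ := hp
  have h := hns i (fun _ => 0) (fun _ => 0) (Function.update (fun _ => 0) i 1)
    fun k hk => by simp [hk]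
  have hz : Function.update (fun _ : ι => (0 : Fin 2)) i 0 = fun _ => 0 :=
    Function.update_eq_self i _
  rw [Fin.sum_univ_two, Fin.sum_univ_two, hz] at h
  linarith [hpos (Function.update (fun _ => 0) i 1) (fun _ => 0)]

theorem mul_le_of_le_add_of_le_add {a b α β α' β' : ℝ} (ha : 0 ≤ a) (hb : 0 ≤ b)
    (hα : 0 ≤ α) (hβ : 0 ≤ β) (hα' : 0 ≤ α') (hβ' : 0 ≤ β')
    (h₁ : a ≤ α + α') (h₂ : b ≤ β + β') :
    a * b ≤ α * b + a * β + α' * β' := by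
  rcases le_total a α with h | h
  · nlinarith [mul_le_mul_of_nonneg_right h hb, mul_nonneg ha hβ, mul_nonneg hα' hβ']
  · nlinarith [mul_le_mul_of_nonneg_left h₂ (sub_nonneg.2 h), mul_nonneg hα hβ,
      mul_le_mul_of_nonneg_right (sub_le_iff_le_add'.2 h₁) hβ']

theorem unitVec_comp_val {n : ℕ} {P : Fin n → Prop} {i : Fin n} (hi : P i) :
    (fun k : {k // P k} => unitVec n i k.1) = Function.update (fun _ => 0) ⟨i, hi⟩ 1 := by
  ext k
  simp [unitVec, Function.update_apply, Subtype.ext_iff]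

theorem unitVec_comp_val_of_not {n : ℕ} {P : Fin n → Prop} {i : Fin n} (hi : ¬ P i) :
    (fun k : {k // P k} => unitVec n i k.1) = fun _ => 0 := by
  ext k
  have hk : k.1 ≠ i := fun h => hi (h ▸ k.2)
  simp [unitVec, hk]

/-- if an `n`-partite correlation `p` (2 inputs / 2 outcomes per party)
is local across a bipartition `S|Sᶜ` with `i ∈ S` and `j ∉ S`, then the lifted CHSH
expression satisfies `I^{i,j}_{0|0}(p) ≤ 0`. -/
theorem statement3 (n : ℕ) (hn : 2 ≤ n) (S : Finset (Fin n)) (i j : Fin n)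
    (hi : i ∈ S) (hj : j ∉ S)
    (p : (Fin n → Fin 2) → (Fin n → Fin 2) → ℝ)
    (hp : IsLocalAcross n 2 2 S p) :
    chshLift i j p ≤ 0 := by
  obtain ⟨N, q, pS, pT, hq, -, hS, hT, hp⟩ := hp
  have hijS : (fun k : {k // k ∈ S} => Function.update (unitVec n i) j 1 k.1) =
      Function.update (fun _ => 0) ⟨i, hi⟩ 1 := by
    rw [← unitVec_comp_val (P := (· ∈ S)) hi]
    ext k
    have hk : k.1 ≠ j := fun h => hj (h ▸ k.2)
    simp [hk]
  have hijT : (fun k : {k // k ∉ S} => Function.update (unitVec n i) j 1 k.1) =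
      Function.update (fun _ => 0) ⟨j, hj⟩ 1 := by
    rw [← unitVec_comp_val (P := (· ∉ S)) hj]
    ext k
    have hk : k.1 ≠ i := fun h => k.2 (h ▸ hi)
    simp [unitVec, Function.update_apply, hk]
  unfold chshLift
  simp only [hp]
  rw [hijS, hijT, unitVec_comp_val (P := (· ∈ S)) hi, unitVec_comp_val (P := (· ∉ S)) hj,
    unitVec_comp_val_of_not (P := (· ∈ S)) hj,
    unitVec_comp_val_of_not (P := (· ∉ S)) (not_not.2 hi),
    ← Finset.sum_sub_distrib, ← Finset.sum_sub_distrib, ← Finset.sum_sub_distrib]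
  refine Finset.sum_nonpos fun l _ => ?_
  have h := mul_le_of_le_add_of_le_add ((hS l).1 _ _) ((hT l).1 _ _) ((hS l).1 _ _)
    ((hT l).1 _ _) ((hS l).1 _ _) ((hT l).1 _ _) ((hS l).zero_le_add ⟨i, hi⟩)
    ((hT l).zero_le_add ⟨j, hj⟩)
  linarith [mul_le_mul_of_nonneg_left h (hq l)]
end

section
/- Let n ≥ 4. Every bilocal n-partite correlation p with 2 inputs and 2 outcomes per party satisfies ∑_{i=3}^{n} I_tri^{1,2,i}(p) ≤ (n−3)·[p(0|0) − p(e_2|e_2) − p(e_1|e_1) − p(e_1|e_1+e_2)], where I_tri^{1,2,i} is the lifted tripartite expression defined in the context, 0 is the all-zero tuple and e_i the tuple with a single 1 in position i. -/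
/-- The outcome (resp. input) tuple of the lifted tripartite expression: value `v1`
at party 1 (index 0), `v2` at party 2 (index 1), `v3` at party `i`, and `0` at all
remaining parties. -/
def triTuple {n : ℕ} (i : Fin n) (v1 v2 v3 : Fin 2) : Fin n → Fin 2 :=
  fun t => if (t : ℕ) = 0 then v1 else if (t : ℕ) = 1 then v2 else if t = i then v3 else 0

/-- The lifted tripartite seed expression `I_tri^{1,2,i}`:
`p(000|000) − p(010|111) − p(000|011) − p(001|001) − p(100|110) − p(010|010) − p(100|100)`
on parties 1, 2, i, with all remaining inputs and outcomes fixed to 0. -/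
def itriLift {n : ℕ} (i : Fin n) (p : (Fin n → Fin 2) → (Fin n → Fin 2) → ℝ) : ℝ :=
  p (triTuple i 0 0 0) (triTuple i 0 0 0) - p (triTuple i 0 1 0) (triTuple i 1 1 1)
    - p (triTuple i 0 0 0) (triTuple i 0 1 1) - p (triTuple i 0 0 1) (triTuple i 0 0 1)
    - p (triTuple i 1 0 0) (triTuple i 1 1 0) - p (triTuple i 0 1 0) (triTuple i 0 1 0)
    - p (triTuple i 1 0 0) (triTuple i 1 0 0)

/-- One-step consequence of non-signaling: changing one party's input and summing over
its outcomes can only increase a probability. -/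
def NSBound {κ : Type} (f : (κ → Fin 2) → (κ → Fin 2) → ℝ) : Prop :=
  (∀ a x, 0 ≤ f a x) ∧
  ∀ (j : κ) (a a' x x' : κ → Fin 2), a j = 0 → a' j = 1 → (∀ k, k ≠ j → a k = a' k) →
    (∀ k, k ≠ j → x k = x' k) → f a x ≤ f a x' + f a' x'

lemma IsNSCorr.nsBound {κ : Type} [Fintype κ] [DecidableEq κ]
    {f : (κ → Fin 2) → (κ → Fin 2) → ℝ} (hf : IsNSCorr 2 2 f) : NSBound f := by
  obtain ⟨h0, -, hns⟩ := hf
  refine ⟨h0, fun j a a' x x' ha ha' haa hxx => ?_⟩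
  have h := hns j a x x' hxx
  have e0 : Function.update a j 0 = a := by rw [← ha, Function.update_eq_self]
  have e1 : Function.update a j 1 = a' := by
    ext k
    by_cases hk : k = j
    · subst hk; simp [ha']
    · simp [hk, haa k hk]
  rw [Fin.sum_univ_two, Fin.sum_univ_two, e0, e1] at h
  linarith [h0 a' x]

section Restriction

variable {n : ℕ} {P : Fin n → Prop} {i : Fin n}

lemma triTuple_restrict_fst (hP : ∀ j : Fin n, (j : ℕ) = 0 → ¬ P j) (v2 v3 : Fin 2) :
    (fun j : {j // P j} => triTuple i 1 v2 v3 j.1) = fun j => triTuple i 0 v2 v3 j.1 := by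
  ext j
  have : (j.1 : ℕ) ≠ 0 := fun h => hP _ h j.2
  simp [triTuple, this]

lemma triTuple_restrict_snd (hP : ∀ j : Fin n, (j : ℕ) = 1 → ¬ P j) (v1 v3 : Fin 2) :
    (fun j : {j // P j} => triTuple i v1 1 v3 j.1) = fun j => triTuple i v1 0 v3 j.1 := by
  ext j
  have : (j.1 : ℕ) ≠ 1 := fun h => hP _ h j.2
  simp [triTuple, this]

lemma triTuple_restrict_thd (hP : ¬ P i) (v1 v2 : Fin 2) :
    (fun j : {j // P j} => triTuple i v1 v2 1 j.1) = fun j => triTuple i v1 v2 0 j.1 := by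
  ext j
  have : j.1 ≠ i := fun h => hP (h ▸ j.2)
  simp [triTuple, this]

variable {f : ({j // P j} → Fin 2) → ({j // P j} → Fin 2) → ℝ}

lemma NSBound.fst (hf : NSBound f) {j : Fin n} (hj : (j : ℕ) = 0) (hP : P j)
    (v2 v3 w w' w2 w3 : Fin 2) :
    f (fun j => triTuple i 0 v2 v3 j.1) (fun j => triTuple i w w2 w3 j.1) ≤
      f (fun j => triTuple i 0 v2 v3 j.1) (fun j => triTuple i w' w2 w3 j.1) +
      f (fun j => triTuple i 1 v2 v3 j.1) (fun j => triTuple i w' w2 w3 j.1) := by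
  have key : ∀ k : {j // P j}, k ≠ ⟨j, hP⟩ → (k.1 : ℕ) ≠ 0 := fun k hk h =>
    hk (Subtype.ext (Fin.ext (h.trans hj.symm)))
  refine hf.2 ⟨j, hP⟩ _ _ _ _ ?_ ?_ (fun k hk => ?_) (fun k hk => ?_)
  · simp [triTuple, hj]
  · simp [triTuple, hj]
  · simp [triTuple, key k hk]
  · simp [triTuple, key k hk]

lemma NSBound.snd (hf : NSBound f) {j : Fin n} (hj : (j : ℕ) = 1) (hP : P j)
    (v1 v3 w w' w1 w3 : Fin 2) :
    f (fun j => triTuple i v1 0 v3 j.1) (fun j => triTuple i w1 w w3 j.1) ≤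
      f (fun j => triTuple i v1 0 v3 j.1) (fun j => triTuple i w1 w' w3 j.1) +
      f (fun j => triTuple i v1 1 v3 j.1) (fun j => triTuple i w1 w' w3 j.1) := by
  have key : ∀ k : {j // P j}, k ≠ ⟨j, hP⟩ → (k.1 : ℕ) ≠ 1 := fun k hk h =>
    hk (Subtype.ext (Fin.ext (h.trans hj.symm)))
  refine hf.2 ⟨j, hP⟩ _ _ _ _ ?_ ?_ (fun k hk => ?_) (fun k hk => ?_)
  · simp [triTuple, hj]
  · simp [triTuple, hj]
  · simp [triTuple, key k hk]
  · simp [triTuple, key k hk]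

lemma NSBound.thd (hf : NSBound f) (hi : 2 ≤ (i : ℕ)) (hP : P i)
    (v1 v2 w w' w1 w2 : Fin 2) :
    f (fun j => triTuple i v1 v2 0 j.1) (fun j => triTuple i w1 w2 w j.1) ≤
      f (fun j => triTuple i v1 v2 0 j.1) (fun j => triTuple i w1 w2 w' j.1) +
      f (fun j => triTuple i v1 v2 1 j.1) (fun j => triTuple i w1 w2 w' j.1) := by
  have key : ∀ k : {j // P j}, k ≠ ⟨i, hP⟩ → k.1 ≠ i := fun k hk h => hk (Subtype.ext h)
  have i0 : (i : ℕ) ≠ 0 := by omega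
  have i1 : (i : ℕ) ≠ 1 := by omega
  refine hf.2 ⟨i, hP⟩ _ _ _ _ ?_ ?_ (fun k hk => ?_) (fun k hk => ?_)
  · simp [triTuple, i0, i1]
  · simp [triTuple, i0, i1]
  · simp [triTuple, key k hk]
  · simp [triTuple, key k hk]

end Restriction

lemma mul_le_of_split {q q₀ q₁ P r s : ℝ} (hq₀ : 0 ≤ q₀) (hq : 0 ≤ q) (hq₁ : 0 ≤ q₁)
    (hP : 0 ≤ P) (hr : 0 ≤ r) (hs : 0 ≤ s) (hsplit : q ≤ q₀ + q₁) (hrs : P ≤ r + s) :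
    q * P ≤ q₁ * P + q₀ * r + q * s := by
  rcases le_total q q₀ with h | h
  · linarith [mul_le_mul_of_nonneg_left hrs hq, mul_le_mul_of_nonneg_right h hr,
      mul_nonneg hq₁ hP]
  · linarith [mul_le_mul_of_nonneg_left hrs hq₀, mul_le_mul_of_nonneg_right h hs,
      mul_le_mul_of_nonneg_right hsplit hP]

section Product

variable {n : ℕ} {P Q : Fin n → Prop} {i z₀ z₁ : Fin n}
  {f : ({j // P j} → Fin 2) → ({j // P j} → Fin 2) → ℝ}
  {g : ({j // Q j} → Fin 2) → ({j // Q j} → Fin 2) → ℝ}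
  {p : (Fin n → Fin 2) → (Fin n → Fin 2) → ℝ}

lemma itriLift_nonpos_of_thd_alone (hPQ : ∀ j, P j → ¬ Q j)
    (hf : NSBound f) (hg : NSBound g)
    (hp : ∀ a x, p a x = f (fun j => a j.1) (fun j => x j.1) * g (fun j => a j.1) (fun j => x j.1))
    (hi : 2 ≤ (i : ℕ)) (hz₀ : (z₀ : ℕ) = 0) (hz₁ : (z₁ : ℕ) = 1)
    (h₀ : P z₀) (h₁ : P z₁) (h₂ : Q i) : itriLift i p ≤ 0 := by
  have n0 : ∀ j : Fin n, (j : ℕ) = 0 → ¬ Q j := fun j hj =>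
    (Fin.ext (hz₀.trans hj.symm) : z₀ = j) ▸ hPQ _ h₀
  have n1 : ∀ j : Fin n, (j : ℕ) = 1 → ¬ Q j := fun j hj =>
    (Fin.ext (hz₁.trans hj.symm) : z₁ = j) ▸ hPQ _ h₁
  have n2 : ¬ P i := fun h => hPQ _ h h₂
  simp only [itriLift, hp, triTuple_restrict_fst n0, triTuple_restrict_snd n1,
    triTuple_restrict_thd n2]
  have A := hg.thd hi h₂ 0 0 0 1 0 0
  have B := hf.snd (i := i) hz₁ h₁ 0 0 0 1 0 0
  have K := mul_le_of_split (hg.1 _ _) (hg.1 _ _) (hg.1 _ _) (hf.1 _ _) (hf.1 _ _) (hf.1 _ _) A B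
  have M := fun a x b y => mul_nonneg (hf.1 a x) (hg.1 b y)
  linarith [M (fun j => triTuple i 0 1 0 j.1) (fun j => triTuple i 1 1 0 j.1)
      (fun j => triTuple i 0 0 0 j.1) (fun j => triTuple i 0 0 1 j.1),
    M (fun j => triTuple i 1 0 0 j.1) (fun j => triTuple i 1 1 0 j.1)
      (fun j => triTuple i 0 0 0 j.1) (fun j => triTuple i 0 0 0 j.1),
    M (fun j => triTuple i 1 0 0 j.1) (fun j => triTuple i 1 0 0 j.1)
      (fun j => triTuple i 0 0 0 j.1) (fun j => triTuple i 0 0 0 j.1)]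

lemma itriLift_nonpos_of_fst_alone (hPQ : ∀ j, P j → ¬ Q j)
    (hf : NSBound f) (hg : NSBound g)
    (hp : ∀ a x, p a x = f (fun j => a j.1) (fun j => x j.1) * g (fun j => a j.1) (fun j => x j.1))
    (hi : 2 ≤ (i : ℕ)) (hz₀ : (z₀ : ℕ) = 0) (hz₁ : (z₁ : ℕ) = 1)
    (h₀ : P z₀) (h₁ : Q z₁) (h₂ : Q i) : itriLift i p ≤ 0 := by
  have n0 : ∀ j : Fin n, (j : ℕ) = 0 → ¬ Q j := fun j hj =>
    (Fin.ext (hz₀.trans hj.symm) : z₀ = j) ▸ hPQ _ h₀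
  have n1 : ∀ j : Fin n, (j : ℕ) = 1 → ¬ P j := fun j hj =>
    (Fin.ext (hz₁.trans hj.symm) : z₁ = j) ▸ fun h => hPQ _ h h₁
  have n2 : ¬ P i := fun h => hPQ _ h h₂
  simp only [itriLift, hp, triTuple_restrict_fst n0, triTuple_restrict_snd n1,
    triTuple_restrict_thd n2]
  have A := hf.fst (i := i) hz₀ h₀ 0 0 0 1 0 0
  have B := hg.thd hi h₂ 0 0 0 1 0 0
  have C := hg.snd (i := i) hz₁ h₁ 0 0 0 1 0 1
  have B' := B.trans (add_le_add_left C _)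
  rw [add_assoc, add_left_comm] at B'
  have K := mul_le_of_split (hf.1 _ _) (hf.1 _ _) (hf.1 _ _) (hg.1 _ _) (hg.1 _ _)
    (add_nonneg (hg.1 _ _) (hg.1 _ _)) A B'
  rw [mul_add] at K
  have M := fun a x b y => mul_nonneg (hf.1 a x) (hg.1 b y)
  linarith [M (fun j => triTuple i 1 0 0 j.1) (fun j => triTuple i 1 0 0 j.1)
      (fun j => triTuple i 0 0 0 j.1) (fun j => triTuple i 0 1 0 j.1),
    M (fun j => triTuple i 0 0 0 j.1) (fun j => triTuple i 0 0 0 j.1)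
      (fun j => triTuple i 0 1 0 j.1) (fun j => triTuple i 0 1 0 j.1)]

lemma itriLift_nonpos_of_snd_alone (hPQ : ∀ j, P j → ¬ Q j)
    (hf : NSBound f) (hg : NSBound g)
    (hp : ∀ a x, p a x = f (fun j => a j.1) (fun j => x j.1) * g (fun j => a j.1) (fun j => x j.1))
    (hi : 2 ≤ (i : ℕ)) (hz₀ : (z₀ : ℕ) = 0) (hz₁ : (z₁ : ℕ) = 1)
    (h₀ : P z₀) (h₁ : Q z₁) (h₂ : P i) : itriLift i p ≤ 0 := by
  have n0 : ∀ j : Fin n, (j : ℕ) = 0 → ¬ Q j := fun j hj =>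
    (Fin.ext (hz₀.trans hj.symm) : z₀ = j) ▸ hPQ _ h₀
  have n1 : ∀ j : Fin n, (j : ℕ) = 1 → ¬ P j := fun j hj =>
    (Fin.ext (hz₁.trans hj.symm) : z₁ = j) ▸ fun h => hPQ _ h h₁
  have n2 : ¬ Q i := hPQ _ h₂
  simp only [itriLift, hp, triTuple_restrict_fst n0, triTuple_restrict_snd n1,
    triTuple_restrict_thd n2]
  have A := hg.snd (i := i) hz₁ h₁ 0 0 0 1 0 0
  have B := hf.thd hi h₂ 0 0 0 1 0 0
  have K := mul_le_of_split (hg.1 _ _) (hg.1 _ _) (hg.1 _ _) (hf.1 _ _) (hf.1 _ _) (hf.1 _ _) A B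
  have M := fun a x b y => mul_nonneg (hf.1 a x) (hg.1 b y)
  linarith [M (fun j => triTuple i 0 0 0 j.1) (fun j => triTuple i 1 0 1 j.1)
      (fun j => triTuple i 0 1 0 j.1) (fun j => triTuple i 0 1 0 j.1),
    M (fun j => triTuple i 1 0 0 j.1) (fun j => triTuple i 1 0 0 j.1)
      (fun j => triTuple i 0 0 0 j.1) (fun j => triTuple i 0 1 0 j.1),
    M (fun j => triTuple i 1 0 0 j.1) (fun j => triTuple i 1 0 0 j.1)
      (fun j => triTuple i 0 0 0 j.1) (fun j => triTuple i 0 0 0 j.1)]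

/-- Some lifted tripartite expression is nonpositive on a product across a bipartition
whose first block contains party 1. -/
lemma exists_itriLift_nonpos (hn : 4 ≤ n) (hPQ : ∀ j, P j → ¬ Q j) (hcov : ∀ j, P j ∨ Q j)
    (hQ : ∃ j, Q j) (hf : NSBound f) (hg : NSBound g)
    (hp : ∀ a x, p a x = f (fun j => a j.1) (fun j => x j.1) * g (fun j => a j.1) (fun j => x j.1))
    (hz₀ : (z₀ : ℕ) = 0) (h₀ : P z₀) : ∃ i : Fin n, 2 ≤ (i : ℕ) ∧ itriLift i p ≤ 0 := by
  have hz₁ : ((⟨1, by omega⟩ : Fin n) : ℕ) = 1 := rfl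
  rcases hcov ⟨1, by omega⟩ with h₁ | h₁
  · obtain ⟨i, hi⟩ := hQ
    have i0 : (i : ℕ) ≠ 0 := fun h => hPQ _ h₀ ((Fin.ext (h.trans hz₀.symm) : i = z₀) ▸ hi)
    have i1 : (i : ℕ) ≠ 1 := fun h => hPQ _ h₁ ((Fin.ext h : i = ⟨1, by omega⟩) ▸ hi)
    have i2 : 2 ≤ (i : ℕ) := by omega
    exact ⟨i, i2, itriLift_nonpos_of_thd_alone hPQ hf hg hp i2 hz₀ hz₁ h₀ h₁ hi⟩
  · have i2 : 2 ≤ ((⟨2, by omega⟩ : Fin n) : ℕ) := le_rfl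
    refine ⟨⟨2, by omega⟩, i2, ?_⟩
    rcases hcov ⟨2, by omega⟩ with h₂ | h₂
    · exact itriLift_nonpos_of_snd_alone hPQ hf hg hp i2 hz₀ hz₁ h₀ h₁ h₂
    · exact itriLift_nonpos_of_fst_alone hPQ hf hg hp i2 hz₀ hz₁ h₀ h₁ h₂

end Product

/-- The part of the lifted tripartite expression that does not depend on the third party. -/
def bipartitePart {n : ℕ} (p : (Fin n → Fin 2) → (Fin n → Fin 2) → ℝ) : ℝ :=
  p (fun _ => 0) (fun _ => 0)
    - p (fun t => if (t : ℕ) = 1 then 1 else 0) (fun t => if (t : ℕ) = 1 then 1 else 0)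
    - p (fun t => if (t : ℕ) = 0 then 1 else 0) (fun t => if (t : ℕ) = 0 then 1 else 0)
    - p (fun t => if (t : ℕ) = 0 then 1 else 0)
        (fun t => if (t : ℕ) = 0 then 1 else if (t : ℕ) = 1 then 1 else 0)

lemma itriLift_le_bipartitePart {n : ℕ} {p : (Fin n → Fin 2) → (Fin n → Fin 2) → ℝ}
    (h0 : ∀ a x, 0 ≤ p a x) (i : Fin n) : itriLift i p ≤ bipartitePart p := by
  have e00 : triTuple i 0 0 0 = fun _ => 0 := by ext; simp [triTuple]
  have e10 : triTuple i 1 0 0 = fun t : Fin n => if (t : ℕ) = 0 then 1 else 0 := by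
    ext; simp [triTuple]
  have e01 : triTuple i 0 1 0 = fun t : Fin n => if (t : ℕ) = 1 then 1 else 0 := by
    ext t; by_cases h : (t : ℕ) = 0 <;> simp [triTuple, h]
  have e11 : triTuple i 1 1 0 =
      fun t : Fin n => if (t : ℕ) = 0 then 1 else if (t : ℕ) = 1 then 1 else 0 := by
    ext; simp [triTuple]
  unfold itriLift bipartitePart
  rw [← e00, ← e10, ← e01, ← e11]
  linarith [h0 (triTuple i 0 1 0) (triTuple i 1 1 1), h0 (triTuple i 0 0 0) (triTuple i 0 1 1),
    h0 (triTuple i 0 0 1) (triTuple i 0 0 1)]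

/-- Right-hand side minus left-hand side of the bilocality inequality. -/
def bilocalGap {n : ℕ} (p : (Fin n → Fin 2) → (Fin n → Fin 2) → ℝ) : ℝ :=
  ((n : ℝ) - 3) * bipartitePart p
    - ∑ i ∈ Finset.univ.filter (fun i : Fin n => 2 ≤ (i : ℕ)), itriLift i p

lemma bilocalGap_sum {n N : ℕ} {p : (Fin n → Fin 2) → (Fin n → Fin 2) → ℝ} {q : Fin N → ℝ}
    {ps : Fin N → (Fin n → Fin 2) → (Fin n → Fin 2) → ℝ}
    (hp : ∀ a x, p a x = ∑ l, q l * ps l a x) :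
    bilocalGap p = ∑ l, q l * bilocalGap (ps l) := by
  have hb : bipartitePart p = ∑ l, q l * bipartitePart (ps l) := by
    simp only [bipartitePart, hp, mul_sub, Finset.sum_sub_distrib]
  have hi : ∀ i, itriLift i p = ∑ l, q l * itriLift i (ps l) := fun i => by
    simp only [itriLift, hp, mul_sub, Finset.sum_sub_distrib]
  simp only [bilocalGap, hb, hi, mul_sub, Finset.sum_sub_distrib, Finset.mul_sum]
  rw [Finset.sum_comm]
  simp only [mul_left_comm]

lemma bilocalGap_nonneg_of_sum {n N : ℕ} {p : (Fin n → Fin 2) → (Fin n → Fin 2) → ℝ}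
    {q : Fin N → ℝ} {ps : Fin N → (Fin n → Fin 2) → (Fin n → Fin 2) → ℝ}
    (hp : ∀ a x, p a x = ∑ l, q l * ps l a x) (hq : ∀ l, 0 ≤ q l)
    (h : ∀ l, 0 ≤ bilocalGap (ps l)) : 0 ≤ bilocalGap p := by
  rw [bilocalGap_sum hp]
  exact Finset.sum_nonneg fun l _ => mul_nonneg (hq l) (h l)

lemma bilocalGap_nonneg_of_exists {n : ℕ} (hn : 4 ≤ n)
    {p : (Fin n → Fin 2) → (Fin n → Fin 2) → ℝ} (h0 : ∀ a x, 0 ≤ p a x)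
    (h : ∃ i : Fin n, 2 ≤ (i : ℕ) ∧ itriLift i p ≤ 0) : 0 ≤ bilocalGap p := by
  obtain ⟨i, hi, hle⟩ := h
  have hmem : i ∈ Finset.univ.filter (fun i : Fin n => 2 ≤ (i : ℕ)) := by simpa using hi
  have hcard : (Finset.univ.filter (fun i : Fin n => 2 ≤ (i : ℕ))).card = n - 2 := by
    have : Finset.univ.filter (fun i : Fin n => 2 ≤ (i : ℕ)) = Finset.Ici ⟨2, by omega⟩ := by
      ext j; simp [Fin.le_def]
    rw [this, Fin.card_Ici]
  have hs := Finset.sum_le_card_nsmul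
    ((Finset.univ.filter (fun i : Fin n => 2 ≤ (i : ℕ))).erase i) (fun j => itriLift j p)
    (bipartitePart p) (fun j _ => itriLift_le_bipartitePart h0 j)
  rw [Finset.card_erase_of_mem hmem, hcard, nsmul_eq_mul, Nat.sub_sub,
    Nat.cast_sub (by omega)] at hs
  push_cast at hs
  unfold bilocalGap
  rw [← Finset.add_sum_erase _ _ hmem]
  linarith

lemma IsLocalAcross.bilocalGap_nonneg {n : ℕ} (hn : 4 ≤ n) {S : Finset (Fin n)}
    (hS : S.Nonempty) (hS' : S ≠ Finset.univ) {p : (Fin n → Fin 2) → (Fin n → Fin 2) → ℝ}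
    (hp : IsLocalAcross n 2 2 S p) : 0 ≤ bilocalGap p := by
  obtain ⟨N, q, f, g, hq, -, hf, hg, hp⟩ := hp
  simp only [mul_assoc] at hp
  refine bilocalGap_nonneg_of_sum
    (ps := fun l a x => f l (fun i => a i.1) (fun i => x i.1) *
      g l (fun i => a i.1) (fun i => x i.1)) hp hq fun l => ?_
  have hfl := (hf l).nsBound
  have hgl := (hg l).nsBound
  refine bilocalGap_nonneg_of_exists hn (fun a x => mul_nonneg (hfl.1 _ _) (hgl.1 _ _)) ?_
  by_cases h₀ : (⟨0, by omega⟩ : Fin n) ∈ S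
  · have hex : ∃ j, j ∉ S := by simpa [Finset.eq_univ_iff_forall] using hS'
    exact exists_itriLift_nonpos (P := fun j => j ∈ S) (Q := fun j => j ∉ S) hn
      (fun j h h' => h' h) (fun j => em _) hex hfl hgl (fun a x => rfl) rfl h₀
  · exact exists_itriLift_nonpos (P := fun j => j ∉ S) (Q := fun j => j ∈ S) hn
      (fun j h h' => h h') (fun j => (em _).symm) hS hgl hfl (fun a x => mul_comm _ _) rfl h₀

/-- every bilocal `n`-partite correlation (2 inputs / 2 outcomes per
party, `n ≥ 4`) satisfies
`∑_{i=3}^n I_tri^{1,2,i}(p) ≤ (n−3)[p(0|0) − p(e₂|e₂) − p(e₁|e₁) − p(e₁|e₁+e₂)]`. -/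
theorem statement5 (n : ℕ) (hn : 4 ≤ n)
    (p : (Fin n → Fin 2) → (Fin n → Fin 2) → ℝ)
    (hp : IsBilocal n 2 2 p) :
    ∑ i ∈ Finset.univ.filter (fun i : Fin n => 2 ≤ (i : ℕ)), itriLift i p ≤
      ((n : ℝ) - 3) *
        (p (fun _ => 0) (fun _ => 0)
          - p (fun t => if (t : ℕ) = 1 then 1 else 0) (fun t => if (t : ℕ) = 1 then 1 else 0)
          - p (fun t => if (t : ℕ) = 0 then 1 else 0) (fun t => if (t : ℕ) = 0 then 1 else 0)
          - p (fun t => if (t : ℕ) = 0 then 1 else 0)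
              (fun t => if (t : ℕ) = 0 then 1 else if (t : ℕ) = 1 then 1 else 0)) := by
  obtain ⟨N, q, ps, S, hq, -, hS, hp⟩ := hp
  exact sub_nonneg.1 <| bilocalGap_nonneg_of_sum hp hq fun l =>
    (hS l).2.2.bilocalGap_nonneg hn (hS l).1 (hS l).2.1
end

section
/- Let n ≥ 1 and 1 ≤ k ≤ n, and let {S_1,…,S_L} be any partition of a set of n elements into disjoint nonempty blocks each of cardinality at most k. Then the number of unordered pairs of elements lying in a common block satisfies ∑_{l=1}^{L} C(|S_l|,2) ≤ ⌊n/k⌋·C(k,2) + C(n mod k, 2), where C(·,2) denotes the binomial coefficient. -/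
/-- Binomial coefficients `C(·, 2)` are convex: spreading two numbers apart, with fixed sum, increases
the sum of their values. -/
theorem choose_two_add_le_of_add_eq {a r k t : ℕ} (h : a + r = k + t) (ha : a ≤ k) (hr : r ≤ k) :
    a.choose 2 + r.choose 2 ≤ k.choose 2 + t.choose 2 := by
  have key : ((a.choose 2 + r.choose 2 : ℕ) : ℚ) ≤ ((k.choose 2 + t.choose 2 : ℕ) : ℚ) := by
    push_cast [Nat.cast_choose_two]
    have h' : (t : ℚ) = a + r - k := by
      have : (a + r : ℚ) = k + t := by exact_mod_cast h
      linarith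
    have ha' : (a : ℚ) ≤ k := by exact_mod_cast ha
    have hr' : (r : ℚ) ≤ k := by exact_mod_cast hr
    rw [h']
    nlinarith [mul_nonneg (sub_nonneg.2 ha') (sub_nonneg.2 hr')]
  exact_mod_cast key

/-- Adding a block of size `a ≤ k` to the extremal configuration on `m` points does not beat the
extremal configuration on `a + m` points. -/
theorem choose_two_add_div_mod_le {a k : ℕ} (hk : 1 ≤ k) (ha : a ≤ k) (m : ℕ) :
    a.choose 2 + (m / k * k.choose 2 + (m % k).choose 2) ≤
      (a + m) / k * k.choose 2 + ((a + m) % k).choose 2 := by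
  have hr : m % k < k := Nat.mod_lt _ hk
  have hm : k * (m / k) + m % k = m := Nat.div_add_mod m k
  generalize m / k = q at *
  generalize m % k = r at *
  subst hm
  rcases lt_or_ge (a + r) k with h | h
  · have e : a + (k * q + r) = a + r + k * q := by ring
    rw [e, Nat.add_mul_div_left _ _ hk, Nat.add_mul_mod_self_left, Nat.div_eq_of_lt h,
      Nat.mod_eq_of_lt h, zero_add]
    have := choose_two_add_le_of_add_eq (add_zero (a + r)).symm
      (Nat.le_add_right a r) (Nat.le_add_left r a)
    simp only [Nat.choose_zero_succ, add_zero] at this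
    omega
  · obtain ⟨t, ht⟩ := Nat.exists_eq_add_of_le h
    have e : a + (k * q + r) = t + k * (q + 1) := by linarith
    have htk : t < k := by omega
    rw [e, Nat.add_mul_div_left _ _ hk, Nat.add_mul_mod_self_left, Nat.div_eq_of_lt htk,
      Nat.mod_eq_of_lt htk, zero_add, add_mul, one_mul]
    have := choose_two_add_le_of_add_eq ht ha hr.le
    omega

/-- A finite family of naturals bounded by `k` has `∑ C(f i, 2)` at most the value attained by the
family with as many entries `k` as possible. -/
theorem sum_choose_two_le_div_mod {ι : Type*} {k : ℕ} (hk : 1 ≤ k) (s : Finset ι) (f : ι → ℕ)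
    (hf : ∀ i ∈ s, f i ≤ k) :
    ∑ i ∈ s, (f i).choose 2 ≤
      (∑ i ∈ s, f i) / k * k.choose 2 + ((∑ i ∈ s, f i) % k).choose 2 := by
  classical
  induction s using Finset.induction_on with
  | empty => simp
  | insert i s hi ih =>
    rw [Finset.sum_insert hi, Finset.sum_insert hi]
    exact (Nat.add_le_add_left (ih fun j hj => hf j (Finset.mem_insert_of_mem hj)) _).trans
      (choose_two_add_div_mod_le hk (hf i (Finset.mem_insert_self i s)) _)

/-- for any partition of a set of `n` elements into nonempty blocks of
size at most `k`, the number of unordered pairs lying in a common block satisfies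
`∑ C(|S_l|, 2) ≤ ⌊n/k⌋·C(k,2) + C(n mod k, 2)`. -/
theorem statement8 (n k : ℕ) (hn : 1 ≤ n) (hk : 1 ≤ k) (hkn : k ≤ n)
    (P : Finpartition (Finset.univ : Finset (Fin n)))
    (hP : ∀ s ∈ P.parts, s.card ≤ k) :
    ∑ s ∈ P.parts, (s.card).choose 2 ≤ n / k * k.choose 2 + (n % k).choose 2 := by
  have h := sum_choose_two_le_div_mod hk P.parts Finset.card hP
  rwa [P.sum_card_parts, Finset.card_univ, Fintype.card_fin] at h
end

section
/- For all real numbers a, b, c, e with a ≥ b > c > 0 and e ≥ 0, there exists α ∈ (0, π/2) such that c²·sin²α − c⁶·sin²α/η₁² − [a²c²·sin α·cos α + (a²e·cos α − bc²·sin α)·(b·cos α + e·sin α)]²/(η₁²·η₂²) > 0, where η₁² = c⁴·sin²α + a⁴·cos²α and η₂² = c²·sin²α + (b·cos α + e·sin α)². -/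
/-- A bound on `N ^ 2` free of denominators that makes the trigonometric expression positive. -/
lemma sub_sub_div_pos_of_sq_lt {a c s k D N : ℝ} (ha : 0 < a) (hk : 0 < k)
    (hsk : s ^ 2 + k ^ 2 = 1) (hD : 0 < D)
    (hN : N ^ 2 < c ^ 2 * s ^ 2 * k ^ 2 * (a ^ 4 - c ^ 4) * D) :
    0 < c ^ 2 * s ^ 2 - c ^ 6 * s ^ 2 / (c ^ 4 * s ^ 2 + a ^ 4 * k ^ 2)
      - N ^ 2 / ((c ^ 4 * s ^ 2 + a ^ 4 * k ^ 2) * D) := by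
  have hE : 0 < c ^ 4 * s ^ 2 + a ^ 4 * k ^ 2 := by positivity
  have key : c ^ 2 * s ^ 2 - c ^ 6 * s ^ 2 / (c ^ 4 * s ^ 2 + a ^ 4 * k ^ 2)
      - N ^ 2 / ((c ^ 4 * s ^ 2 + a ^ 4 * k ^ 2) * D)
      = (c ^ 2 * s ^ 2 * k ^ 2 * (a ^ 4 - c ^ 4) * D - N ^ 2) /
        ((c ^ 4 * s ^ 2 + a ^ 4 * k ^ 2) * D) := by
    field_simp
    linear_combination c ^ 6 * s ^ 2 * D * hsk
  rw [key]
  exact div_pos (sub_pos.2 hN) (mul_pos hE hD)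

/-- for reals `a ≥ b > c > 0` and `e ≥ 0` there is `α ∈ (0, π/2)` with
`c² sin²α − c⁶ sin²α/η₁² − [a²c² sin α cos α + (a²e cos α − bc² sin α)(b cos α + e sin α)]²/(η₁²η₂²) > 0`,
where `η₁² = c⁴ sin²α + a⁴ cos²α` and `η₂² = c² sin²α + (b cos α + e sin α)²`. -/
theorem statement11 (a b c e : ℝ) (hab : b ≤ a) (hbc : c < b) (hc : 0 < c) (he : 0 ≤ e) :
    ∃ α ∈ Set.Ioo (0 : ℝ) (Real.pi / 2),
      0 < c ^ 2 * Real.sin α ^ 2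
          - c ^ 6 * Real.sin α ^ 2 / (c ^ 4 * Real.sin α ^ 2 + a ^ 4 * Real.cos α ^ 2)
          - (a ^ 2 * c ^ 2 * Real.sin α * Real.cos α +
              (a ^ 2 * e * Real.cos α - b * c ^ 2 * Real.sin α) *
                (b * Real.cos α + e * Real.sin α)) ^ 2 /
            ((c ^ 4 * Real.sin α ^ 2 + a ^ 4 * Real.cos α ^ 2) *
              (c ^ 2 * Real.sin α ^ 2 + (b * Real.cos α + e * Real.sin α) ^ 2)) := by
  have hb : 0 < b := hc.trans hbc
  have ha : 0 < a := hb.trans_le hab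
  have hac : 0 < a ^ 4 - c ^ 4 :=
    sub_pos.2 (pow_lt_pow_left₀ (hbc.trans_le hab) hc.le (by norm_num))
  have sin_pos {α : ℝ} (hα : α ∈ Set.Ioo (0 : ℝ) (Real.pi / 2)) : 0 < Real.sin α :=
    Real.sin_pos_of_pos_of_lt_pi hα.1 (by linarith [hα.2, Real.pi_pos])
  have cos_pos {α : ℝ} (hα : α ∈ Set.Ioo (0 : ℝ) (Real.pi / 2)) : 0 < Real.cos α :=
    Real.cos_pos_of_mem_Ioo ⟨by linarith [hα.1, Real.pi_pos], hα.2⟩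
  rcases he.eq_or_lt with rfl | he
  · have hα : Real.pi / 4 ∈ Set.Ioo (0 : ℝ) (Real.pi / 2) :=
      ⟨by positivity, by linarith [Real.pi_pos]⟩
    refine ⟨Real.pi / 4, hα, ?_⟩
    have hs := sin_pos hα
    have hk := cos_pos hα
    have hsk := Real.sin_sq_add_cos_sq (Real.pi / 4)
    generalize Real.sin (Real.pi / 4) = s at *
    generalize Real.cos (Real.pi / 4) = k at *
    refine sub_sub_div_pos_of_sq_lt ha hk hsk (by positivity) ?_
    have hbc2 : c ^ 2 < b ^ 2 := pow_lt_pow_left₀ hbc hc.le (by norm_num)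
    have hab2 : b ^ 2 ≤ a ^ 2 := pow_le_pow_left₀ hb.le hab 2
    have h₁ : c ^ 2 < c ^ 2 * s ^ 2 + b ^ 2 * k ^ 2 := by
      nlinarith [mul_pos (sub_pos.2 hbc2) (pow_pos hk 2)]
    have h₂ : (a ^ 2 - b ^ 2) ^ 2 < a ^ 4 - c ^ 4 := by
      nlinarith [mul_nonneg (sq_nonneg b) (sub_nonneg.2 hab2), pow_pos hc 2]
    have h₃ : (a ^ 2 - b ^ 2) ^ 2 * c ^ 2
        < (a ^ 4 - c ^ 4) * (c ^ 2 * s ^ 2 + b ^ 2 * k ^ 2) :=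
      mul_lt_mul h₂ h₁.le (by positivity) hac.le
    have h₄ := mul_lt_mul_of_pos_left h₃ (show 0 < c ^ 2 * s ^ 2 * k ^ 2 by positivity)
    linear_combination h₄
  · obtain ⟨α, hα, hN⟩ : (0 : ℝ) ∈ (fun α => a ^ 2 * c ^ 2 * Real.sin α * Real.cos α +
        (a ^ 2 * e * Real.cos α - b * c ^ 2 * Real.sin α) *
          (b * Real.cos α + e * Real.sin α)) '' Set.Ioo (0 : ℝ) (Real.pi / 2) := by
      refine intermediate_value_Ioo' (by positivity) (by fun_prop) ⟨?_, ?_⟩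
      · simp only [Real.sin_pi_div_two, Real.cos_pi_div_two]
        have : 0 < b * c ^ 2 * e := by positivity
        linarith
      · simp only [Real.sin_zero, Real.cos_zero]
        have : 0 < a ^ 2 * e * b := by positivity
        linarith
    have hs := sin_pos hα
    have hk := cos_pos hα
    refine ⟨α, hα, sub_sub_div_pos_of_sq_lt ha hk (Real.sin_sq_add_cos_sq α) (by positivity) ?_⟩
    beta_reduce at hN
    rw [hN, zero_pow two_ne_zero]
    positivity
end

section
/- Fix reals a, b, c, d, e with a ≥ b > c > 0, d ≥ 0, e ≥ 0, a real phase φ, and α ∈ (0, π/2). Let ψ ∈ ℂ²⊗ℂ²⊗ℂ² be the vector with coordinates ψ(0,0,0) = a·e^{iφ}, ψ(0,1,1) = b, ψ(1,0,1) = c, ψ(1,1,0) = d, ψ(1,1,1) = e and all other coordinates zero, and define the unit vectors M^{(1)}_{0|0} = cos α·|0⟩ + sin α·|1⟩, M^{(1)}_{0|1} = (−c²·sin α·|0⟩ + a²·cos α·|1⟩)/η₁, M^{(2)}_{0|0} = |0⟩, M^{(2)}_{0|1} = (c·sin α·|0⟩ + (b·cos α + e·sin α)·|1⟩)/η₂,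 M^{(3)}_{0|0} = |1⟩, M^{(3)}_{0|1} = (e^{iφ}·a·cos α·|0⟩ + c·sin α·|1⟩)/η₃, with η₁² = c⁴sin²α + a⁴cos²α, η₂² = c²sin²α + (b cos α + e sin α)², η₃² = a²cos²α + c²sin²α. Then: (1) for every vector m₃ ∈ ℂ² orthogonal to M^{(3)}_{0|1}, ⟨M^{(1)}_{0|0} ⊗ M^{(2)}_{0|0} ⊗ m₃, ψ⟩ = 0; (2) for every vector m₂ ∈ ℂ² orthogonal to M^{(2)}_{0|1}, ⟨M^{(1)}_{0|0} ⊗ m₂ ⊗ M^{(3)}_{0|0}, ψ⟩ = 0; (3) ⟨M^{(1)}_{0|1} ⊗ M^{(2)}_{0|0} ⊗ M^{(3)}_{0|1}, ψ⟩ = 0. -/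
noncomputable section

/-- Hermitian inner product on `ℂ²`: `⟨u, v⟩ = ∑ conj(uᵢ) vᵢ`. -/
def inner2 (u v : Fin 2 → ℂ) : ℂ :=
  ∑ i, (starRingEnd ℂ) (u i) * v i

/-- Hermitian inner product on `ℂ²⊗ℂ²⊗ℂ²`, identified with functions `{0,1}³ → ℂ`. -/
def inner3 (u v : Fin 2 → Fin 2 → Fin 2 → ℂ) : ℂ :=
  ∑ i, ∑ j, ∑ k, (starRingEnd ℂ) (u i j k) * v i j k

/-- The tensor product `u ⊗ v ⊗ w` (here `tprod3`) of three vectors of `ℂ²`. -/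
def tprod3 (u v w : Fin 2 → ℂ) : Fin 2 → Fin 2 → Fin 2 → ℂ :=
  fun i j k => u i * v j * w k

/-- The three-qubit state
`ψ = a e^{iφ}|000⟩ + b|011⟩ + c|101⟩ + d|110⟩ + e|111⟩`. -/
def psiState (a b c d e φ : ℝ) : Fin 2 → Fin 2 → Fin 2 → ℂ :=
  fun i j k =>
    if i = 0 ∧ j = 0 ∧ k = 0 then (a : ℂ) * Complex.exp ((φ : ℂ) * Complex.I)
    else if i = 0 ∧ j = 1 ∧ k = 1 then (b : ℂ)
    else if i = 1 ∧ j = 0 ∧ k = 1 then (c : ℂ)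
    else if i = 1 ∧ j = 1 ∧ k = 0 then (d : ℂ)
    else if i = 1 ∧ j = 1 ∧ k = 1 then (e : ℂ)
    else 0

/-- Normalization constant `η₁ = √(c⁴ sin²α + a⁴ cos²α)`. -/
def eta1 (a c α : ℝ) : ℝ := Real.sqrt (c ^ 4 * Real.sin α ^ 2 + a ^ 4 * Real.cos α ^ 2)

/-- Normalization constant `η₂ = √(c² sin²α + (b cos α + e sin α)²)`. -/
def eta2 (b c e α : ℝ) : ℝ :=
  Real.sqrt (c ^ 2 * Real.sin α ^ 2 + (b * Real.cos α + e * Real.sin α) ^ 2)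

/-- Normalization constant `η₃ = √(a² cos²α + c² sin²α)`. -/
def eta3 (a c α : ℝ) : ℝ := Real.sqrt (a ^ 2 * Real.cos α ^ 2 + c ^ 2 * Real.sin α ^ 2)

/-- `M⁽¹⁾₀|₀ = cos α |0⟩ + sin α |1⟩`. -/
def M1x0 (α : ℝ) : Fin 2 → ℂ := ![((Real.cos α : ℝ) : ℂ), ((Real.sin α : ℝ) : ℂ)]

/-- `M⁽¹⁾₀|₁ = (−c² sin α |0⟩ + a² cos α |1⟩)/η₁`. -/
def M1x1 (a c α : ℝ) : Fin 2 → ℂ :=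
  ![((-(c ^ 2 * Real.sin α) / eta1 a c α : ℝ) : ℂ),
    ((a ^ 2 * Real.cos α / eta1 a c α : ℝ) : ℂ)]

/-- `M⁽²⁾₀|₀ = |0⟩`. -/
def M2x0 : Fin 2 → ℂ := ![1, 0]

/-- `M⁽²⁾₀|₁ = (c sin α |0⟩ + (b cos α + e sin α)|1⟩)/η₂`. -/
def M2x1 (b c e α : ℝ) : Fin 2 → ℂ :=
  ![((c * Real.sin α / eta2 b c e α : ℝ) : ℂ),
    (((b * Real.cos α + e * Real.sin α) / eta2 b c e α : ℝ) : ℂ)]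

/-- `M⁽³⁾₀|₀ = |1⟩`. -/
def M3x0 : Fin 2 → ℂ := ![0, 1]

/-- `M⁽³⁾₀|₁ = (e^{iφ} a cos α |0⟩ + c sin α |1⟩)/η₃`. -/
def M3x1 (a c φ α : ℝ) : Fin 2 → ℂ :=
  ![Complex.exp ((φ : ℂ) * Complex.I) * ((a * Real.cos α / eta3 a c α : ℝ) : ℂ),
    ((c * Real.sin α / eta3 a c α : ℝ) : ℂ)]

end

open scoped ComplexConjugate

theorem eta2_ne_zero {b c e α : ℝ} (h : c * Real.sin α ≠ 0) : eta2 b c e α ≠ 0 := by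
  have := sq_pos_of_ne_zero h
  refine (Real.sqrt_pos.mpr ?_).ne'
  nlinarith [sq_nonneg (b * Real.cos α + e * Real.sin α)]

theorem eta3_ne_zero {a c α : ℝ} (h : c * Real.sin α ≠ 0) : eta3 a c α ≠ 0 := by
  have := sq_pos_of_ne_zero h
  refine (Real.sqrt_pos.mpr ?_).ne'
  nlinarith [sq_nonneg (a * Real.cos α)]

theorem inner3_tprod3_psiState (a b c d e φ : ℝ) (u v w : Fin 2 → ℂ) :
    inner3 (tprod3 u v w) (psiState a b c d e φ) =
      conj (u 0) * conj (v 0) * conj (w 0) * (a * Complex.exp (φ * Complex.I)) +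
      conj (u 0) * conj (v 1) * conj (w 1) * b + conj (u 1) * conj (v 0) * conj (w 1) * c +
      conj (u 1) * conj (v 1) * conj (w 0) * d + conj (u 1) * conj (v 1) * conj (w 1) * e := by
  simp [inner3, tprod3, psiState, Fin.sum_univ_two]
  ring

theorem conj_exp_mul_I_mul_self (φ : ℝ) :
    conj (Complex.exp (φ * Complex.I)) * Complex.exp (φ * Complex.I) = 1 := by
  rw [← Complex.exp_conj, ← Complex.exp_add]
  simp

/-- for the state `ψ` of Eq. (A1) and the measurement vectors of the
proof of Theorem 2, (1) `⟨M⁽¹⁾₀|₀ ⊗ M⁽²⁾₀|₀ ⊗ m₃, ψ⟩ = 0` for every `m₃ ⊥ M⁽³⁾₀|₁`,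
(2) `⟨M⁽¹⁾₀|₀ ⊗ m₂ ⊗ M⁽³⁾₀|₀, ψ⟩ = 0` for every `m₂ ⊥ M⁽²⁾₀|₁`, and
(3) `⟨M⁽¹⁾₀|₁ ⊗ M⁽²⁾₀|₀ ⊗ M⁽³⁾₀|₁, ψ⟩ = 0`. -/
theorem statement12 (a b c d e φ α : ℝ) (hab : b ≤ a) (hbc : c < b) (hc : 0 < c)
    (hd : 0 ≤ d) (he : 0 ≤ e) (hα : α ∈ Set.Ioo (0 : ℝ) (Real.pi / 2)) :
    (∀ m3 : Fin 2 → ℂ, inner2 (M3x1 a c φ α) m3 = 0 →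
      inner3 (tprod3 (M1x0 α) M2x0 m3) (psiState a b c d e φ) = 0) ∧
    (∀ m2 : Fin 2 → ℂ, inner2 (M2x1 b c e α) m2 = 0 →
      inner3 (tprod3 (M1x0 α) m2 M3x0) (psiState a b c d e φ) = 0) ∧
    inner3 (tprod3 (M1x1 a c α) M2x0 (M3x1 a c φ α)) (psiState a b c d e φ) = 0 := by
  have hs : c * Real.sin α ≠ 0 :=
    (mul_pos hc (Real.sin_pos_of_pos_of_lt_pi hα.1 (by linarith [hα.2, Real.pi_pos]))).ne'
  refine ⟨fun m3 hm => ?_, fun m2 hm => ?_, ?_⟩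
  · have hη : (eta3 a c α : ℂ) ≠ 0 := Complex.ofReal_ne_zero.mpr (eta3_ne_zero hs)
    have h := congrArg conj hm
    simp only [inner2, M3x1, Fin.sum_univ_two, Matrix.cons_val_zero, Matrix.cons_val_one,
      map_add, map_mul, Complex.conj_conj, map_zero, Complex.ofReal_div,
      Complex.ofReal_mul] at h
    field_simp at h
    simp only [inner3_tprod3_psiState, M1x0, M2x0, Matrix.cons_val_zero, Matrix.cons_val_one,
      Complex.conj_ofReal, map_one, map_zero]
    linear_combination h
  · have hη : (eta2 b c e α : ℂ) ≠ 0 := Complex.ofReal_ne_zero.mpr (eta2_ne_zero hs)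
    have h := congrArg conj hm
    simp only [inner2, M2x1, Fin.sum_univ_two, Matrix.cons_val_zero, Matrix.cons_val_one,
      map_add, map_mul, map_div₀, Complex.conj_ofReal, map_zero, Complex.ofReal_div,
      Complex.ofReal_mul, Complex.ofReal_add] at h
    field_simp at h
    simp only [inner3_tprod3_psiState, M1x0, M3x0, Matrix.cons_val_zero, Matrix.cons_val_one,
      Complex.conj_ofReal, map_one, map_zero]
    linear_combination h
  · simp only [inner3_tprod3_psiState, M1x1, M2x0, M3x1, Matrix.cons_val_zero,
      Matrix.cons_val_one, map_mul, map_div₀, map_neg, map_pow, Complex.conj_ofReal, map_one, map_zero,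
      Complex.ofReal_div, Complex.ofReal_mul, Complex.ofReal_neg, Complex.ofReal_pow]
    linear_combination (-(c ^ 2 * Real.sin α) / eta1 a c α * (a * Real.cos α / eta3 a c α) * a : ℂ)
      * conj_exp_mul_I_mul_self φ
end

section
/- Every bilocal tripartite correlation p with 2 inputs and 3 outcomes per party satisfies I^{1,2}(p) + I^{1,3}(p) + I^{2,3}(p) ≤ p(001|000) + p(010|000) + p(011|000) + p(100|000) + p(101|000) + p(110|000), where I^{i,j} = J₃^{i,j}(1|0) + J̃₃^{i,j}(0|0) is built from the three-outcome CGLMP-type expressions J₃ and J̃₃ defined in the context. -/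
/-- The outcome tuple assigning `u` to party `i`, `v` to party `j`, and the fixed
outcome `γ` to the remaining party. -/
def outT (i j : Fin 3) (γ u v : Fin 3) : Fin 3 → Fin 3 :=
  fun t => if t = i then u else if t = j then v else γ

/-- The input tuple assigning `u` to party `i`, `v` to party `j`, and input `0` to
the remaining party. -/
def inpT (i j : Fin 3) (u v : Fin 2) : Fin 3 → Fin 2 :=
  fun t => if t = i then u else if t = j then v else 0

/-- The CGLMP-type expression `J₃` on parties `i, j`, lifted with the remaining
party's input fixed to `0` and outcome fixed to `γ`. -/
def J3lift (i j : Fin 3) (γ : Fin 3) (p : (Fin 3 → Fin 3) → (Fin 3 → Fin 2) → ℝ) : ℝ :=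
  p (outT i j γ 0 1) (inpT i j 0 0) + p (outT i j γ 0 0) (inpT i j 0 0)
    + p (outT i j γ 1 0) (inpT i j 0 0)
    - p (outT i j γ 0 1) (inpT i j 0 1) - p (outT i j γ 0 2) (inpT i j 0 1)
    - p (outT i j γ 1 2) (inpT i j 0 1)
    - p (outT i j γ 1 0) (inpT i j 1 1) - p (outT i j γ 2 0) (inpT i j 1 1)
    - p (outT i j γ 2 1) (inpT i j 1 1)
    - p (outT i j γ 0 1) (inpT i j 1 0) - p (outT i j γ 0 0) (inpT i j 1 0)
    - p (outT i j γ 1 0) (inpT i j 1 0)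

/-- The expression `J̃₃` (obtained from `J₃` by exchanging outcomes `0 ↔ 1` of both
parties) on parties `i, j`, lifted with the remaining party's input fixed to `0` and
outcome fixed to `γ`. -/
def J3tlift (i j : Fin 3) (γ : Fin 3) (p : (Fin 3 → Fin 3) → (Fin 3 → Fin 2) → ℝ) : ℝ :=
  p (outT i j γ 1 0) (inpT i j 0 0) + p (outT i j γ 1 1) (inpT i j 0 0)
    + p (outT i j γ 0 1) (inpT i j 0 0)
    - p (outT i j γ 1 0) (inpT i j 0 1) - p (outT i j γ 1 2) (inpT i j 0 1)
    - p (outT i j γ 0 2) (inpT i j 0 1)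
    - p (outT i j γ 0 1) (inpT i j 1 1) - p (outT i j γ 2 1) (inpT i j 1 1)
    - p (outT i j γ 2 0) (inpT i j 1 1)
    - p (outT i j γ 1 0) (inpT i j 1 0) - p (outT i j γ 1 1) (inpT i j 1 0)
    - p (outT i j γ 0 1) (inpT i j 1 0)

/-- `I^{i,j} = J₃^{i,j}(1|0) + J̃₃^{i,j}(0|0)`. -/
def Iij (i j : Fin 3) (p : (Fin 3 → Fin 3) → (Fin 3 → Fin 2) → ℝ) : ℝ :=
  J3lift i j 1 p + J3tlift i j 0 p

/-- The difference of the two sides of the three-party inequality. -/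
def bellDefect (p : (Fin 3 → Fin 3) → (Fin 3 → Fin 2) → ℝ) : ℝ :=
  Iij 0 1 p + Iij 0 2 p + Iij 1 2 p -
    (p ![0, 0, 1] (fun _ => 0) + p ![0, 1, 0] (fun _ => 0) + p ![0, 1, 1] (fun _ => 0)
      + p ![1, 0, 0] (fun _ => 0) + p ![1, 0, 1] (fun _ => 0) + p ![1, 1, 0] (fun _ => 0))

theorem bellDefect_sum {κ : Type} [Fintype κ] (w : κ → ℝ)
    (r : κ → (Fin 3 → Fin 3) → (Fin 3 → Fin 2) → ℝ) :
    bellDefect (fun a x => ∑ l, w l * r l a x) = ∑ l, w l * bellDefect (r l) := by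
  simp only [bellDefect, Iij, J3lift, J3tlift, ← Finset.sum_add_distrib,
    ← Finset.sum_sub_distrib]
  exact Finset.sum_congr rfl fun l _ => by ring

theorem bellDefect_nonpos_of_mixture {κ : Type} [Fintype κ]
    {p : (Fin 3 → Fin 3) → (Fin 3 → Fin 2) → ℝ} {w : κ → ℝ}
    {r : κ → (Fin 3 → Fin 3) → (Fin 3 → Fin 2) → ℝ} (hw : ∀ l, 0 ≤ w l)
    (hr : ∀ l, bellDefect (r l) ≤ 0) (hp : ∀ a x, p a x = ∑ l, w l * r l a x) :
    bellDefect p ≤ 0 := by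
  obtain rfl : p = fun a x => ∑ l, w l * r l a x := funext₂ hp
  rw [bellDefect_sum]
  exact Finset.sum_nonpos fun l _ => mul_nonpos_of_nonneg_of_nonpos (hw l) (hr l)

/-- Nonnegativity and the non-signaling conditions for a two-party table `P a b x y`. -/
structure IsNSTable (P : Fin 3 → Fin 3 → Fin 2 → Fin 2 → ℝ) : Prop where
  nonneg : ∀ a b x y, 0 ≤ P a b x y
  left : ∀ b y, ∑ a, P a b 0 y = ∑ a, P a b 1 y
  right : ∀ a x, ∑ b, P a b x 0 = ∑ b, P a b x 1

/-- The three ways of singling out one party `s`, with the other two parties `j < k`. -/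
def IsSplit (s j k : Fin 3) : Prop :=
  (s = 0 ∧ j = 1 ∧ k = 2) ∨ (s = 1 ∧ j = 0 ∧ k = 2) ∨ (s = 2 ∧ j = 0 ∧ k = 1)

instance (s j k : Fin 3) : Decidable (IsSplit s j k) := by
  unfold IsSplit; infer_instance

set_option maxHeartbeats 4000000 in
theorem bellDefect_deterministic_nonpos {s j k : Fin 3} (h : IsSplit s j k)
    {P : Fin 3 → Fin 3 → Fin 2 → Fin 2 → ℝ} (hP : IsNSTable P) (c : Fin 3 × Fin 3) :
    bellDefect (fun a x =>
      (if x s = 0 then if a s = c.1 then 1 else 0 else if a s = c.2 then 1 else 0)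
        * P (a j) (a k) (x j) (x k)) ≤ 0 := by
  have hn := hP.nonneg
  have hl := hP.left
  have hr := hP.right
  simp only [Fin.forall_fin_succ, Fin.sum_univ_three, Fin.succ_zero_eq_one,
    Fin.succ_one_eq_two, IsEmpty.forall_iff, and_true] at hn hl hr
  casesm* _ ∧ _
  obtain ⟨c₀, c₁⟩ := c
  rcases h with ⟨rfl, rfl, rfl⟩ | ⟨rfl, rfl, rfl⟩ | ⟨rfl, rfl, rfl⟩ <;>
    fin_cases c₀ <;> fin_cases c₁ <;>
    simp [bellDefect, Iij, J3lift, J3tlift, outT, inpT] <;>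
    linarith

theorem bellDefect_product_nonpos {s j k : Fin 3} (h : IsSplit s j k)
    {Q : Fin 3 → Fin 2 → ℝ} (hQ : ∀ a x, 0 ≤ Q a x) (hQ1 : ∀ x, ∑ a, Q a x = 1)
    {P : Fin 3 → Fin 3 → Fin 2 → Fin 2 → ℝ} (hP : IsNSTable P) :
    bellDefect (fun a x => Q (a s) (x s) * P (a j) (a k) (x j) (x k)) ≤ 0 := by
  refine bellDefect_nonpos_of_mixture (κ := Fin 3 × Fin 3)
    (w := fun c => Q c.1 0 * Q c.2 1) (fun c => mul_nonneg (hQ _ _) (hQ _ _))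
    (bellDefect_deterministic_nonpos h hP) fun a x => ?_
  simp only [← mul_assoc, ← Finset.sum_mul]
  congr 1
  rw [Fintype.sum_prod_type]
  generalize x s = y
  fin_cases y
  · rw [Finset.sum_comm]
    simp [← Finset.mul_sum, hQ1]
  · simp [← Finset.sum_mul, hQ1]

theorem IsNSCorr.sum_const {ι : Type} [Fintype ι] [DecidableEq ι] {d m : ℕ}
    {p : (ι → Fin d) → (ι → Fin m) → ℝ} (hp : IsNSCorr d m p) (i : ι) (hi : ∀ t, t = i)
    (x : ι → Fin m) : ∑ v, p (fun _ => v) x = 1 := by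
  rw [← hp.2.1 x]
  refine Fintype.sum_bijective (fun v _ => v) ⟨fun u v h => congrFun h i, fun a => ?_⟩ _ _
    fun _ => rfl
  exact ⟨a i, funext fun t => by rw [hi t]⟩

theorem IsNSCorr.isNSTable {ι : Type} [Fintype ι] [DecidableEq ι]
    {p : (ι → Fin 3) → (ι → Fin 2) → ℝ} (hp : IsNSCorr 3 2 p) {j k : ι} (hjk : j ≠ k)
    (h : ∀ t, t = j ∨ t = k) :
    IsNSTable (fun a b x y =>
      p (fun t => if t = j then a else b) (fun t => if t = j then x else y)) := by
  have hj (a v b : Fin 3) : Function.update (fun t => if t = j then a else b) j v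
      = fun t => if t = j then v else b := by
    ext t; rcases h t with rfl | rfl <;> simp [hjk.symm]
  have hk (a v b : Fin 3) : Function.update (fun t => if t = j then a else b) k v
      = fun t => if t = j then a else v := by
    ext t; rcases h t with rfl | rfl <;> simp [hjk, hjk.symm]
  refine ⟨fun _ _ _ _ => hp.1 _ _, fun b y => ?_, fun a x => ?_⟩
  · have := hp.2.2 j (fun t => if t = j then 0 else b) (fun t => if t = j then 0 else y)
      (fun t => if t = j then 1 else y) (fun t ht => by simp [ht])
    simpa only [hj] using this
  · have := hp.2.2 k (fun t => if t = j then a else 0) (fun t => if t = j then x else 0)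
      (fun t => if t = j then x else 1)
      (fun t ht => by simp [(h t).resolve_right ht])
    simpa only [hk] using this

theorem bellDefect_blocks_nonpos {s j k : Fin 3} (h : IsSplit s j k)
    {D E : Fin 3 → Prop} [Fintype {i // D i}] [Fintype {i // E i}]
    [DecidableEq {i // D i}] [DecidableEq {i // E i}]
    (hD : ∀ t, D t ↔ t = s) (hE : ∀ t, E t ↔ t = j ∨ t = k)
    {q : ({i // D i} → Fin 3) → ({i // D i} → Fin 2) → ℝ} (hq : IsNSCorr 3 2 q)
    {r : ({i // E i} → Fin 3) → ({i // E i} → Fin 2) → ℝ} (hr : IsNSCorr 3 2 r) :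
    bellDefect (fun a x =>
      q (fun i => a i.1) (fun i => x i.1) * r (fun i => a i.1) (fun i => x i.1)) ≤ 0 := by
  have hjk : j ≠ k := by
    rcases h with ⟨-, rfl, rfl⟩ | ⟨-, rfl, rfl⟩ | ⟨-, rfl, rfl⟩ <;> decide
  have hT := hr.isNSTable (j := ⟨j, (hE j).2 (.inl rfl)⟩) (k := ⟨k, (hE k).2 (.inr rfl)⟩)
    (fun e => hjk (congrArg Subtype.val e))
    (fun t => ((hE t).1 t.2).imp Subtype.ext Subtype.ext)
  have key := bellDefect_product_nonpos h (Q := fun a x => q (fun _ => a) (fun _ => x))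
    (fun _ _ => hq.1 _ _)
    (fun _ => hq.sum_const ⟨s, (hD s).2 rfl⟩ (fun t => Subtype.ext ((hD t).1 t.2)) _) hT
  have hs {α : Type} (a : Fin 3 → α) :
      (fun _ => a s : {i // D i} → α) = fun i => a i.1 :=
    funext fun i => by rw [(hD i).1 i.2]
  have hb {α : Type} (a : Fin 3 → α) :
      (fun t => if t = ⟨j, (hE j).2 (.inl rfl)⟩ then a j else a k : {i // E i} → α)
        = fun i => a i.1 := by
    funext ⟨t, ht⟩
    rcases (hE t).1 ht with rfl | rfl <;> simp [hjk.symm]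
  simpa only [hs, hb] using key

theorem exists_isSplit_of_bipartition (S : Finset (Fin 3)) (h₀ : S.Nonempty)
    (h₁ : S ≠ Finset.univ) :
    ∃ s j k, IsSplit s j k ∧ (S = {s} ∨ S = {j, k}) := by
  revert S; decide

theorem IsSplit.not_mem_iff {s j k : Fin 3} (h : IsSplit s j k) (t : Fin 3) :
    ¬ (t = s) ↔ t = j ∨ t = k := by
  revert s j k t; decide

theorem IsLocalAcross.bellDefect_nonpos {S : Finset (Fin 3)} (h₀ : S.Nonempty)
    (h₁ : S ≠ Finset.univ) {p : (Fin 3 → Fin 3) → (Fin 3 → Fin 2) → ℝ}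
    (hp : IsLocalAcross 3 3 2 S p) : bellDefect p ≤ 0 := by
  obtain ⟨N, q, pS, pT, hq, -, hS, hT, hp⟩ := hp
  simp only [mul_assoc] at hp
  refine bellDefect_nonpos_of_mixture hq (fun l => ?_) hp
  obtain ⟨s, j, k, h, hSs | hSjk⟩ := exists_isSplit_of_bipartition S h₀ h₁
  · exact bellDefect_blocks_nonpos h (D := (· ∈ S)) (E := (· ∉ S)) (by simp [hSs])
      (fun t => by rw [hSs, Finset.mem_singleton, h.not_mem_iff]) (hS l) (hT l)
  · simp only [mul_comm (pS l _ _)]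
    exact bellDefect_blocks_nonpos h (D := (· ∉ S)) (E := (· ∈ S))
      (fun t => by
        rw [hSjk, Finset.mem_insert, Finset.mem_singleton, ← h.not_mem_iff, not_not])
      (by simp [hSjk]) (hT l) (hS l)

/-- every bilocal tripartite correlation with 2 inputs and 3 outcomes
per party satisfies `I^{1,2}(p) + I^{1,3}(p) + I^{2,3}(p) ≤ I₊(p)`, where `I₊(p)` is
the sum of the six probabilities `p(a|000)` for
`a ∈ {001, 010, 011, 100, 101, 110}`. -/
theorem statement17 (p : (Fin 3 → Fin 3) → (Fin 3 → Fin 2) → ℝ)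
    (hp : IsBilocal 3 3 2 p) :
    Iij 0 1 p + Iij 0 2 p + Iij 1 2 p ≤
      p ![0, 0, 1] (fun _ => 0) + p ![0, 1, 0] (fun _ => 0) + p ![0, 1, 1] (fun _ => 0)
        + p ![1, 0, 0] (fun _ => 0) + p ![1, 0, 1] (fun _ => 0)
        + p ![1, 1, 0] (fun _ => 0) := by
  obtain ⟨N, q, ps, S, hq, -, hS, hp⟩ := hp
  exact sub_nonpos.1 (bellDefect_nonpos_of_mixture hq
    (fun l => (hS l).2.2.bellDefect_nonpos (hS l).1 (hS l).2.1) hp)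
end
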